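/- There is an absolute constant C such that for every weight ω on ℝ with [ω]_{A₂} < ∞ and every J ∈ 𝒟: ∑_{K∈𝒟, K⊆J} ⟨ω^{-1}⟩_K ⟨ω, h_{K₋}⟩² ≤ C [ω]_{A₂}² ω(J). -/

import Mathlib

open MeasureTheory ENNReal NNReal

noncomputable section

/-- The dyadic interval `[2^n k, 2^n (k+1))`, encoded by the pair `p = (n, k)`. -/
def dyad (p : ℤ × ℤ) : Set ℝ := Set.Ico ((2:ℝ) ^ p.1 * p.2) ((2:ℝ) ^ p.1 * (p.2 + 1))

/-- The length `2^n` of the dyadic interval encoded by `p = (n, k)`. -/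
def len (p : ℤ × ℤ) : ℝ := (2:ℝ) ^ p.1

/-- The left half `I₋` of the dyadic interval. -/
def lhalf (p : ℤ × ℤ) : ℤ × ℤ := (p.1 - 1, 2 * p.2)

/-- The right half `I₊` of the dyadic interval. -/
def rhalf (p : ℤ × ℤ) : ℤ × ℤ := (p.1 - 1, 2 * p.2 + 1)

/-- The average `⟨f⟩_I = |I|⁻¹ ∫_I f` over the dyadic interval `p`. -/
def avg (f : ℝ → ℝ) (p : ℤ × ℤ) : ℝ := (len p)⁻¹ * ∫ x in dyad p, f x

/-- The Haar function `h_I = |I|^{-1/2} (1_{I₋} - 1_{I₊})`. -/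
def haar (p : ℤ × ℤ) : ℝ → ℝ := fun x =>
  (Real.sqrt (len p))⁻¹ *
    ((dyad (lhalf p)).indicator (fun _ => (1:ℝ)) x -
      (dyad (rhalf p)).indicator (fun _ => (1:ℝ)) x)

/-- The Haar coefficient `⟨f, h_I⟩ = ∫ f h_I`. -/
def haarCoeff (f : ℝ → ℝ) (p : ℤ × ℤ) : ℝ := ∫ x, f x * haar p x

/-- The A₂ characteristic `[ω]_{A₂} = sup_I ⟨ω⟩_I ⟨ω⁻¹⟩_I`, valued in `ℝ≥0∞`. -/
def A2 (ω : ℝ → ℝ) : ℝ≥0∞ :=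
  ⨆ p : ℤ × ℤ, ENNReal.ofReal (avg ω p * avg (fun x => (ω x)⁻¹) p)

/-- `ω` is a weight: measurable, positive, with `ω` and `ω⁻¹` locally integrable. -/
def IsWeight (ω : ℝ → ℝ) : Prop :=
  Measurable ω ∧ (∀ x, 0 < ω x) ∧
    LocallyIntegrable ω volume ∧ LocallyIntegrable (fun x => (ω x)⁻¹) volume

/-- The measure `ω dx`. -/
def wMeasure (ω : ℝ → ℝ) : Measure ℝ := volume.withDensity fun x => ENNReal.ofReal (ω x)

/-- `ω^{1/2}`. -/
def sqrtw (ω : ℝ → ℝ) : ℝ → ℝ := fun x => Real.sqrt (ω x)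

/-- `ω^{-1/2}`. -/
def invSqrtw (ω : ℝ → ℝ) : ℝ → ℝ := fun x => (Real.sqrt (ω x))⁻¹

/-- `μ(I) = ∫_I μ`. -/
def wInt (μ : ℝ → ℝ) (p : ℤ × ℤ) : ℝ := ∫ x in dyad p, μ x

/-- `⟨f, h¹_I⟩_μ = |I|⁻¹ ∫_I f μ`. -/
def wavg (f μ : ℝ → ℝ) (p : ℤ × ℤ) : ℝ := (len p)⁻¹ * ∫ x in dyad p, f x * μ x

/-- `⟨f, g⟩_μ = ∫ f g μ`. -/
def wip (f g μ : ℝ → ℝ) : ℝ := ∫ x, f x * g x * μ x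

/-- `C_K(μ) = (⟨μ⟩_{K₊} ⟨μ⟩_{K₋} / ⟨μ⟩_K)^{1/2}`. -/
def CK (μ : ℝ → ℝ) (p : ℤ × ℤ) : ℝ :=
  Real.sqrt (avg μ (rhalf p) * avg μ (lhalf p) / avg μ p)

/-- `D_K(μ) = ⟨μ, h_K⟩ / ⟨μ⟩_K`. -/
def DK (μ : ℝ → ℝ) (p : ℤ × ℤ) : ℝ := haarCoeff μ p / avg μ p

/-- The `L²(μ)`-normalized weighted Haar function
`h^μ_K = μ(K)^{-1/2} ((μ(K₊)/μ(K₋))^{1/2} 1_{K₋} − (μ(K₋)/μ(K₊))^{1/2} 1_{K₊})`. -/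
def wHaar (μ : ℝ → ℝ) (p : ℤ × ℤ) : ℝ → ℝ := fun x =>
  (Real.sqrt (wInt μ p))⁻¹ *
    (Real.sqrt (wInt μ (rhalf p) / wInt μ (lhalf p)) *
        (dyad (lhalf p)).indicator (fun _ => (1:ℝ)) x -
      Real.sqrt (wInt μ (lhalf p) / wInt μ (rhalf p)) *
        (dyad (rhalf p)).indicator (fun _ => (1:ℝ)) x)

/-! ### The elementary inequality behind the Bellman function -/

lemma sqrt_one_add_le {s : ℝ} (h1 : -1 < s) (h2 : s < 1) :
    Real.sqrt (1 + s) ≤ 1 + s / 2 - s ^ 2 / 16 := by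
  apply Real.sqrt_le_iff.mpr
  constructor
  · nlinarith
  · nlinarith [mul_nonneg (sq_nonneg s) (by linarith : (0:ℝ) ≤ 1 - s), sq_nonneg (s ^ 2)]

lemma average_sqrt_div_le {s t : ℝ} (hs1 : -1 < s) (hs2 : s < 1) (ht1 : -1 < t) (ht2 : t < 1) :
    (Real.sqrt ((1 + s) / (1 + t)) + Real.sqrt ((1 - s) / (1 - t))) / 2 ≤
      1 + 3 / 2 * (t ^ 2 / (1 - t ^ 2)) - s ^ 2 / 32 := by
  have hP := sqrt_one_add_le hs1 hs2
  have hM := sqrt_one_add_le (s := -s) (by linarith) (by linarith)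
  rw [Real.sqrt_div (by linarith), Real.sqrt_div (by linarith)]
  have hp : 0 < 1 + t := by linarith
  have hm : 0 < 1 - t := by linarith
  have hpm : 0 < 1 - t ^ 2 := by nlinarith
  set E := t ^ 2 / (1 - t ^ 2) with hE
  have hE0 : 0 ≤ E := by positivity
  obtain ⟨P, hPdef⟩ : ∃ P, P = (Real.sqrt (1 + t))⁻¹ := ⟨_, rfl⟩
  obtain ⟨M, hMdef⟩ : ∃ M, M = (Real.sqrt (1 - t))⁻¹ := ⟨_, rfl⟩
  have hP0 : 0 < P := by rw [hPdef]; positivity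
  have hM0 : 0 < M := by rw [hMdef]; positivity
  have hP2 : P ^ 2 = (1 + t)⁻¹ := by rw [hPdef, inv_pow, Real.sq_sqrt hp.le]
  have hM2 : M ^ 2 = (1 - t)⁻¹ := by rw [hMdef, inv_pow, Real.sq_sqrt hm.le]
  have hsum : P ^ 2 + M ^ 2 = 2 * (1 + E) := by
    rw [hP2, hM2, hE]
    have : 1 - t ^ 2 = (1 + t) * (1 - t) := by ring
    rw [this]
    field_simp
    ring
  have hPM : 1 ≤ P * M := by
    have : (P * M) ^ 2 = 1 + E := by
      rw [mul_pow, hP2, hM2, hE]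
      have : 1 - t ^ 2 = (1 + t) * (1 - t) := by ring
      rw [this]
      field_simp
      ring
    nlinarith [mul_pos hP0 hM0]
  have hge : 2 ≤ P + M := by nlinarith [sq_nonneg (P - M)]
  have hle : P + M ≤ 2 + E := by
    by_contra h
    push Not at h
    nlinarith [sq_nonneg (P - M)]
  have hD : (P - M) ^ 2 ≤ 2 * E := by nlinarith
  rw [div_eq_mul_inv (Real.sqrt (1 + s)), div_eq_mul_inv (Real.sqrt (1 - s)), ← hPdef, ← hMdef]
  have e1 := mul_le_mul_of_nonneg_right hP hP0.le
  have e2 := mul_le_mul_of_nonneg_right hM hM0.le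
  rw [← sub_eq_add_neg] at e2
  have e3 := mul_nonneg (sq_nonneg s) (by linarith : (0:ℝ) ≤ P + M - 2)
  nlinarith [sq_nonneg (s / 4 - (P - M))]

/-- The Bellman function `(u, v) ↦ (3/2) A (u - 1/v) + √(A u / v)`. -/
def bellman (A u v : ℝ) : ℝ := 3 / 2 * A * u - 3 / 2 * A / v + Real.sqrt (A * u / v)

lemma bellman_nonneg {A u v : ℝ} (hA : 0 ≤ A) (hv : 0 < v) (h1 : 1 ≤ u * v) :
    0 ≤ bellman A u v := by
  have h2 : 1 / v ≤ u := by rwa [div_le_iff₀ hv]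
  have h3 : 3 / 2 * A / v = 3 / 2 * A * (1 / v) := by ring
  have h4 := mul_le_mul_of_nonneg_left h2 (by positivity : 0 ≤ 3 / 2 * A)
  have := Real.sqrt_nonneg (A * u / v)
  unfold bellman
  linarith

lemma sqrt_mul_div_le {A u v : ℝ} (hA : 0 ≤ A) (hv : 0 < v) (h : u * v ≤ A) :
    Real.sqrt (A * u / v) ≤ A / v := by
  apply Real.sqrt_le_iff.mpr
  refine ⟨by positivity, ?_⟩
  rw [div_pow, div_le_div_iff₀ hv (by positivity)]
  nlinarith [mul_le_mul_of_nonneg_left h (by positivity : 0 ≤ A * v)]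

lemma bellman_le {A u v : ℝ} (hA : 0 ≤ A) (hv : 0 < v) (h : u * v ≤ A) :
    bellman A u v ≤ 3 / 2 * A * u := by
  have h1 := sqrt_mul_div_le hA hv h
  have h2 : 3 / 2 * A / v = 3 / 2 * (A / v) := by ring
  have h3 : 0 ≤ A / v := by positivity
  unfold bellman
  linarith

lemma bellman_concavity {A a b c d : ℝ} (ha : 0 < a) (hb : 0 < b) (hc : 0 < c)
    (hd : 0 < d) (h : (a + b) / 2 * ((c + d) / 2) ≤ A) :
    ((a - b) / 2) ^ 2 / ((a + b) / 2) / 32 + (bellman A a c + bellman A b d) / 2 ≤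
      bellman A ((a + b) / 2) ((c + d) / 2) := by
  obtain ⟨u, hu⟩ : ∃ u, u = (a + b) / 2 := ⟨_, rfl⟩
  obtain ⟨v, hv⟩ : ∃ v, v = (c + d) / 2 := ⟨_, rfl⟩
  rw [← hu, ← hv] at h ⊢
  have hu0 : 0 < u := by rw [hu]; positivity
  have hv0 : 0 < v := by rw [hv]; positivity
  have hA : 0 < A := lt_of_lt_of_le (by positivity) h
  obtain ⟨s, hs⟩ : ∃ s, s = (a - b) / 2 / u := ⟨_, rfl⟩
  obtain ⟨t, ht⟩ : ∃ t, t = (c - d) / 2 / v := ⟨_, rfl⟩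
  have hsu : s * u = (a - b) / 2 := by rw [hs]; field_simp
  have htv : t * v = (c - d) / 2 := by rw [ht]; field_simp
  have ha' : a = u * (1 + s) := by linarith
  have hb' : b = u * (1 - s) := by linarith
  have hc' : c = v * (1 + t) := by linarith
  have hd' : d = v * (1 - t) := by linarith
  have hs1 : 0 < 1 + s := by rw [ha'] at ha; exact pos_of_mul_pos_right ha hu0.le
  have hs2 : 0 < 1 - s := by rw [hb'] at hb; exact pos_of_mul_pos_right hb hu0.le
  have ht1 : 0 < 1 + t := by rw [hc'] at hc; exact pos_of_mul_pos_right hc hv0.le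
  have ht2 : 0 < 1 - t := by rw [hd'] at hd; exact pos_of_mul_pos_right hd hv0.le
  have key := average_sqrt_div_le (s := s) (t := t) (by linarith) (by linarith) (by linarith)
    (by linarith)
  have hpm : 1 - t ^ 2 = (1 + t) * (1 - t) := by ring
  have hpm0 : 0 < 1 - t ^ 2 := by rw [hpm]; positivity
  obtain ⟨Y, hY⟩ : ∃ Y, Y = Real.sqrt (A * u / v) := ⟨_, rfl⟩
  have hY1 : Y ≤ A / v := by rw [hY]; exact sqrt_mul_div_le hA.le hv0 h
  have hY2 : u ≤ Y := by
    rw [hY]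
    apply Real.le_sqrt_of_sq_le
    rw [le_div_iff₀ hv0]
    nlinarith
  have hY0 : 0 ≤ Y := by linarith
  have r1 : Real.sqrt (A * a / c) = Y * Real.sqrt ((1 + s) / (1 + t)) := by
    rw [hY, ← Real.sqrt_mul (by positivity), ha', hc']
    congr 1
    field_simp
  have r2 : Real.sqrt (A * b / d) = Y * Real.sqrt ((1 - s) / (1 - t)) := by
    rw [hY, ← Real.sqrt_mul (by positivity), hb', hd']
    congr 1
    field_simp
  obtain ⟨E, hE⟩ : ∃ E, E = t ^ 2 / (1 - t ^ 2) := ⟨_, rfl⟩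
  have hE0 : 0 ≤ E := by rw [hE]; positivity
  have r3 : (3 / 2 * A / c + 3 / 2 * A / d) / 2 = 3 / 2 * (A / v) * (1 + E) := by
    rw [hE, hc', hd', hpm]
    field_simp
    ring
  have r4 : ((a - b) / 2) ^ 2 / u = u * s ^ 2 := by
    rw [← hsu]
    field_simp
  rw [← hE] at key
  unfold bellman
  rw [r4, r1, r2, ← hY]
  have k1 := mul_le_mul_of_nonneg_left key hY0
  have k2 := mul_le_mul_of_nonneg_right hY2 (sq_nonneg s)
  have k3 := mul_le_mul_of_nonneg_right hY1 hE0
  have r5 : 3 / 2 * A / v = 3 / 2 * (A / v) := by ring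
  have r6 : A * a + A * b = 2 * (A * u) := by rw [hu]; ring
  rw [r5]
  linarith

/-! ### Dyadic intervals -/

lemma len_pos (p : ℤ × ℤ) : 0 < len p := zpow_pos (by norm_num) _

lemma two_zpow_sub_one_mul_two (n : ℤ) : (2:ℝ) ^ (n - 1) * 2 = 2 ^ n := by
  rw [← zpow_add_one₀ (by norm_num)]; simp

lemma len_lhalf (p : ℤ × ℤ) : len (lhalf p) = len p / 2 := by
  have := two_zpow_sub_one_mul_two p.1
  simp only [len, lhalf]
  linarith

lemma len_rhalf (p : ℤ × ℤ) : len (rhalf p) = len p / 2 := len_lhalf p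

lemma dyad_lhalf (p : ℤ × ℤ) :
    dyad (lhalf p) = Set.Ico (len p * p.2) (len p * p.2 + len p / 2) := by
  have := two_zpow_sub_one_mul_two p.1
  simp only [dyad, len, lhalf]
  push_cast
  rw [← this]
  congr 1 <;> ring

lemma dyad_rhalf (p : ℤ × ℤ) :
    dyad (rhalf p) = Set.Ico (len p * p.2 + len p / 2) (len p * (p.2 + 1)) := by
  have := two_zpow_sub_one_mul_two p.1
  simp only [dyad, len, rhalf]
  push_cast
  rw [← this]
  congr 1 <;> ring

lemma dyad_eq_union (p : ℤ × ℤ) : dyad p = dyad (lhalf p) ∪ dyad (rhalf p) := by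
  have := len_pos p
  rw [dyad_lhalf, dyad_rhalf, Set.Ico_union_Ico_eq_Ico (by linarith) (by linarith)]
  rfl

lemma disjoint_dyad_halves (p : ℤ × ℤ) : Disjoint (dyad (lhalf p)) (dyad (rhalf p)) := by
  rw [dyad_lhalf, dyad_rhalf]
  exact Set.Ico_disjoint_Ico_same

lemma measurableSet_dyad (p : ℤ × ℤ) : MeasurableSet (dyad p) := measurableSet_Ico

lemma volume_dyad (p : ℤ × ℤ) : volume (dyad p) = ENNReal.ofReal (len p) := by
  simp only [dyad, Real.volume_Ico, len]
  congr 1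
  ring

lemma left_lt_right (p : ℤ × ℤ) : (2:ℝ) ^ p.1 * p.2 < (2:ℝ) ^ p.1 * (p.2 + 1) := by
  have := len_pos p
  simp only [len] at this
  linarith

lemma scale_le_of_dyad_subset {p q : ℤ × ℤ} (h : dyad p ⊆ dyad q) : p.1 ≤ q.1 := by
  have h' := (Set.Ico_subset_Ico_iff (left_lt_right p)).1 h
  have : (2:ℝ) ^ p.1 ≤ 2 ^ q.1 := by linarith [h'.1, h'.2]
  exact (zpow_le_zpow_iff_right₀ (by norm_num)).1 this

lemma eq_of_dyad_subset {p q : ℤ × ℤ} (h : dyad p ⊆ dyad q) (hs : p.1 = q.1) : p = q := by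
  have h' := (Set.Ico_subset_Ico_iff (left_lt_right p)).1 h
  have hp : (0:ℝ) < 2 ^ q.1 := len_pos q
  rw [hs, mul_le_mul_iff_right₀ hp, mul_le_mul_iff_right₀ hp] at h'
  have h1 : q.2 ≤ p.2 := by exact_mod_cast h'.1
  have h2 : p.2 + 1 ≤ q.2 + 1 := by exact_mod_cast h'.2
  exact Prod.ext hs (by omega)

lemma dyad_subset_half {p q : ℤ × ℤ} (h : dyad p ⊆ dyad q) (hs : p.1 < q.1) :
    dyad p ⊆ dyad (lhalf q) ∨ dyad p ⊆ dyad (rhalf q) := by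
  have h' := (Set.Ico_subset_Ico_iff (left_lt_right p)).1 h
  obtain ⟨m, hm⟩ : ∃ m : ℕ, q.1 - 1 = p.1 + m :=
    ⟨(q.1 - 1 - p.1).toNat, by omega⟩
  have hp : (0:ℝ) < 2 ^ p.1 := len_pos p
  have hmid : len q * q.2 + len q / 2 = 2 ^ p.1 * ((2 ^ m * (2 * q.2 + 1) : ℤ) : ℝ) := by
    have e : len q = 2 ^ p.1 * 2 ^ m * 2 := by
      rw [len, ← two_zpow_sub_one_mul_two, hm, zpow_add₀ (by norm_num), zpow_natCast]
    rw [e]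
    push_cast
    ring
  rw [dyad_lhalf, dyad_rhalf, hmid]
  rcases le_or_gt (2 ^ m * (2 * q.2 + 1)) p.2 with hle | hlt
  · right
    refine Set.Ico_subset_Ico ?_ h'.2
    exact mul_le_mul_of_nonneg_left (by exact_mod_cast hle) hp.le
  · left
    refine Set.Ico_subset_Ico h'.1 ?_
    exact mul_le_mul_of_nonneg_left (by exact_mod_cast hlt) hp.le

lemma lhalf_injective : Function.Injective lhalf := by
  rintro ⟨a, b⟩ ⟨c, d⟩ h
  simp only [lhalf, Prod.mk.injEq] at h ⊢
  omega

/-- The dyadic subintervals of `q` of generation less than `n`. -/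
def descendants : ℕ → ℤ × ℤ → Finset (ℤ × ℤ)
  | 0, _ => ∅
  | n + 1, q => insert q (descendants n (lhalf q) ∪ descendants n (rhalf q))

lemma mem_descendants {p : ℤ × ℤ} (n : ℕ) :
    ∀ q : ℤ × ℤ, dyad p ⊆ dyad q → q.1 - p.1 < n → p ∈ descendants n q := by
  induction n with
  | zero =>
    intro q h hn
    have := scale_le_of_dyad_subset h
    push_cast at hn
    omega
  | succ n ih =>
    intro q h hn
    push_cast at hn
    simp only [descendants, Finset.mem_insert, Finset.mem_union]
    rcases (scale_le_of_dyad_subset h).eq_or_lt with hs | hs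
    · exact Or.inl (eq_of_dyad_subset h hs)
    · rcases dyad_subset_half h hs with h' | h'
      · exact Or.inr (Or.inl (ih _ h' (by simp only [lhalf]; omega)))
      · exact Or.inr (Or.inr (ih _ h' (by simp only [rhalf]; omega)))

lemma sum_insert_union_le {α : Type*} [DecidableEq α] (f : α → ℝ≥0∞) (a : α) (s t : Finset α) :
    ∑ x ∈ insert a (s ∪ t), f x ≤ f a + (∑ x ∈ s, f x + ∑ x ∈ t, f x) := by
  have h1 : ∑ x ∈ s ∪ t, f x ≤ ∑ x ∈ s, f x + ∑ x ∈ t, f x := by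
    rw [← Finset.sum_union_inter]
    exact le_self_add
  by_cases h : a ∈ s ∪ t
  · rw [Finset.insert_eq_of_mem h]
    exact h1.trans le_add_self
  · rw [Finset.sum_insert h]
    gcongr

/-- Summation over all dyadic subintervals is controlled by any dyadic supersolution. -/
lemma tsum_dyad_subset_le {f F : ℤ × ℤ → ℝ≥0∞}
    (h : ∀ q, f q + (F (lhalf q) + F (rhalf q)) ≤ F q) (q : ℤ × ℤ) :
    ∑' p : {p : ℤ × ℤ // dyad p ⊆ dyad q}, f p.1 ≤ F q := by
  have hfin : ∀ (n : ℕ) (q : ℤ × ℤ), ∑ p ∈ descendants n q, f p ≤ F q := by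
    intro n
    induction n with
    | zero => intro q; simp [descendants]
    | succ n ih =>
      intro q
      refine (sum_insert_union_le _ _ _ _).trans (le_trans ?_ (h q))
      gcongr
      · exact ih _
      · exact ih _
  rw [ENNReal.tsum_eq_iSup_sum]
  refine iSup_le fun s => ?_
  obtain ⟨n, hn⟩ : ∃ n : ℕ, ∀ p ∈ s, q.1 - p.1.1 < n := by
    refine ⟨s.sup (fun p => (q.1 - p.1.1).toNat) + 1, fun p hp => ?_⟩
    have := Finset.le_sup (f := fun p : {p : ℤ × ℤ // dyad p ⊆ dyad q} =>
      (q.1 - p.1.1).toNat) hp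
    push_cast
    omega
  calc ∑ p ∈ s, f p.1 = ∑ p ∈ s.map (Function.Embedding.subtype _), f p := by
        rw [Finset.sum_map]; rfl
    _ ≤ ∑ p ∈ descendants n q, f p := by
        refine Finset.sum_le_sum_of_subset fun p hp => ?_
        obtain ⟨x, hx, rfl⟩ := Finset.mem_map.1 hp
        exact mem_descendants n q x.2 (hn x hx)
    _ ≤ F q := hfin n q

/-! ### Averages and Haar coefficients -/

lemma integrableOn_dyad {f : ℝ → ℝ} (hf : LocallyIntegrable f volume) (p : ℤ × ℤ) :
    IntegrableOn f (dyad p) volume :=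
  (hf.integrableOn_isCompact isCompact_Icc).mono_set Set.Ico_subset_Icc_self

lemma avg_pos {f : ℝ → ℝ} (hf : LocallyIntegrable f volume) (h0 : ∀ x, 0 < f x) (p : ℤ × ℤ) :
    0 < avg f p := by
  refine mul_pos (inv_pos.2 (len_pos p)) ?_
  rw [setIntegral_pos_iff_support_of_nonneg_ae (Filter.Eventually.of_forall fun x => (h0 x).le)
    (integrableOn_dyad hf p)]
  have : Function.support f = Set.univ := by
    ext x; simp [(h0 x).ne']
  rw [this, Set.univ_inter, volume_dyad]
  exact ENNReal.ofReal_pos.2 (len_pos p)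

lemma integral_dyad (f : ℝ → ℝ) (p : ℤ × ℤ) : ∫ x in dyad p, f x = len p * avg f p := by
  rw [avg, mul_inv_cancel_left₀ (len_pos p).ne']

lemma avg_eq_halves {f : ℝ → ℝ} (hf : LocallyIntegrable f volume) (p : ℤ × ℤ) :
    avg f p = (avg f (lhalf p) + avg f (rhalf p)) / 2 := by
  have h : ∫ x in dyad p, f x = (∫ x in dyad (lhalf p), f x) + ∫ x in dyad (rhalf p), f x := by
    rw [dyad_eq_union, setIntegral_union (disjoint_dyad_halves p) (measurableSet_dyad _)
      (integrableOn_dyad hf _) (integrableOn_dyad hf _)]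
  have hl := len_pos p
  rw [integral_dyad, integral_dyad, integral_dyad, len_lhalf, len_rhalf] at h
  have : len p * avg f p = len p * ((avg f (lhalf p) + avg f (rhalf p)) / 2) := by
    rw [h]; ring
  exact mul_left_cancel₀ hl.ne' this

lemma haarCoeff_sq {f : ℝ → ℝ} (hf : LocallyIntegrable f volume) (p : ℤ × ℤ) :
    haarCoeff f p ^ 2 = len p * ((avg f (lhalf p) - avg f (rhalf p)) / 2) ^ 2 := by
  have hl := len_pos p
  have e : ∀ x, f x * haar p x = (Real.sqrt (len p))⁻¹ *
      ((dyad (lhalf p)).indicator f x - (dyad (rhalf p)).indicator f x) := by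
    intro x
    by_cases h1 : x ∈ dyad (lhalf p) <;> by_cases h2 : x ∈ dyad (rhalf p) <;>
      simp [haar, h1, h2, mul_comm]
  have h : haarCoeff f p = (Real.sqrt (len p))⁻¹ *
      ((∫ x in dyad (lhalf p), f x) - ∫ x in dyad (rhalf p), f x) := by
    rw [haarCoeff]
    simp_rw [e]
    rw [integral_const_mul, integral_sub, integral_indicator (measurableSet_dyad _),
      integral_indicator (measurableSet_dyad _)]
    · exact (integrable_indicator_iff (measurableSet_dyad _)).2 (integrableOn_dyad hf _)
    · exact (integrable_indicator_iff (measurableSet_dyad _)).2 (integrableOn_dyad hf _)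
  rw [h, integral_dyad, integral_dyad, len_lhalf, len_rhalf, mul_pow, inv_pow,
    Real.sq_sqrt hl.le]
  field_simp

lemma one_le_avg_mul_avg_inv {ω : ℝ → ℝ} (hω : IsWeight ω) (p : ℤ × ℤ) :
    1 ≤ avg ω p * avg (fun x => (ω x)⁻¹) p := by
  obtain ⟨-, h0, hi, hi'⟩ := hω
  have hu := avg_pos hi h0 p
  have hl := len_pos p
  set u := avg ω p with hudef
  have hpt : ∀ x, 2 ≤ u⁻¹ * ω x + u * (ω x)⁻¹ := by
    intro x
    have := h0 x
    have e : u⁻¹ * ω x + u * (ω x)⁻¹ - 2 = (ω x - u) ^ 2 / (u * ω x) := by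
      field_simp
      ring
    have : 0 ≤ (ω x - u) ^ 2 / (u * ω x) := by positivity
    linarith
  have hfin : volume (dyad p) ≠ ⊤ := by rw [volume_dyad]; exact ENNReal.ofReal_ne_top
  have hint := setIntegral_mono (μ := volume) (s := dyad p) (f := fun _ => (2:ℝ))
    (integrableOn_const hfin)
    (((integrableOn_dyad hi p).const_mul u⁻¹).add ((integrableOn_dyad hi' p).const_mul u)) hpt
  rw [setIntegral_const, integral_add' ((integrableOn_dyad hi p).const_mul u⁻¹)
    ((integrableOn_dyad hi' p).const_mul u), integral_const_mul, integral_const_mul,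
    integral_dyad, integral_dyad, measureReal_def, volume_dyad, ENNReal.toReal_ofReal hl.le,
    smul_eq_mul, ← hudef] at hint
  have h3 : u⁻¹ * (len p * u) = len p := by field_simp
  rw [h3] at hint
  by_contra hlt
  push Not at hlt
  nlinarith [mul_lt_mul_of_pos_left hlt hl]

lemma avg_mul_avg_inv_le {ω : ℝ → ℝ} (hA : A2 ω < ⊤) (p : ℤ × ℤ) :
    avg ω p * avg (fun x => (ω x)⁻¹) p ≤ (A2 ω).toReal := by
  rw [← ENNReal.ofReal_le_iff_le_toReal hA.ne]
  exact le_iSup (fun p => ENNReal.ofReal (avg ω p * avg (fun x => (ω x)⁻¹) p)) p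

/-- Buckley-type estimate: `∑_{K ⊆ J} ⟨ω, h_K⟩² / ⟨ω⟩_K ≤ 48 [ω]_{A₂} ω(J)`. -/
lemma tsum_haarCoeff_sq_div_avg_le {ω : ℝ → ℝ} (hω : IsWeight ω) (hA : A2 ω < ⊤) (q : ℤ × ℤ) :
    ∑' p : {p : ℤ × ℤ // dyad p ⊆ dyad q},
        ENNReal.ofReal (haarCoeff ω p.1 ^ 2 / avg ω p.1) ≤
      ENNReal.ofReal (48 * (A2 ω).toReal * wInt ω q) := by
  have hA0 : 0 ≤ (A2 ω).toReal := ENNReal.toReal_nonneg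
  have hone := one_le_avg_mul_avg_inv hω
  have hle := avg_mul_avg_inv_le hA
  obtain ⟨-, h0, hi, hi'⟩ := hω
  have h0' : ∀ x, 0 < (ω x)⁻¹ := fun x => inv_pos.2 (h0 x)
  set A := (A2 ω).toReal
  set v := avg fun x => (ω x)⁻¹ with hv
  have hu0 := avg_pos hi h0
  have hv0 := avg_pos hi' h0'
  rw [← hv] at hv0
  have hB : ∀ p, 0 ≤ bellman A (avg ω p) (v p) := fun p => bellman_nonneg hA0 (hv0 p) (hone p)
  refine (tsum_dyad_subset_le
    (f := fun p => ENNReal.ofReal (haarCoeff ω p ^ 2 / avg ω p))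
    (F := fun p => ENNReal.ofReal (32 * len p * bellman A (avg ω p) (v p)))
    (fun p => ?_) q).trans (ENNReal.ofReal_le_ofReal ?_)
  · have hl := len_pos p
    have hl1 := len_pos (lhalf p)
    have hl2 := len_pos (rhalf p)
    have hB1 := hB (lhalf p)
    have hB2 := hB (rhalf p)
    have hup := hu0 p
    rw [← ENNReal.ofReal_add (by positivity) (by positivity),
      ← ENNReal.ofReal_add (by positivity) (by positivity)]
    refine ENNReal.ofReal_le_ofReal ?_
    have e1 := avg_eq_halves hi p
    have e2 : v p = (v (lhalf p) + v (rhalf p)) / 2 := avg_eq_halves hi' p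
    have hAp := hle p
    rw [e1, e2] at hAp
    have key := bellman_concavity (hu0 (lhalf p)) (hu0 (rhalf p)) (hv0 (lhalf p))
      (hv0 (rhalf p)) hAp
    rw [← e1, ← e2] at key
    rw [haarCoeff_sq hi, len_lhalf, len_rhalf, mul_div_assoc]
    have := mul_le_mul_of_nonneg_left key (by positivity : 0 ≤ 32 * len p)
    linarith
  · have := mul_le_mul_of_nonneg_left (bellman_le hA0 (hv0 q) (hle q))
      (by have := len_pos q; positivity : 0 ≤ 32 * len q)
    rw [wInt, integral_dyad]
    linarith

lemma avg_inv_mul_haarCoeff_sq_le {ω : ℝ → ℝ} (hω : IsWeight ω) (hA : A2 ω < ⊤) (p : ℤ × ℤ) :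
    avg (fun x => (ω x)⁻¹) p * haarCoeff ω (lhalf p) ^ 2 ≤
      2 * (A2 ω).toReal * (haarCoeff ω (lhalf p) ^ 2 / avg ω (lhalf p)) := by
  have hle := avg_mul_avg_inv_le hA p
  obtain ⟨-, h0, hi, hi'⟩ := hω
  have hu := avg_pos hi h0 (lhalf p)
  have hu' := avg_pos hi h0 (rhalf p)
  have hv := avg_pos hi' (fun x => inv_pos.2 (h0 x)) p
  rw [avg_eq_halves hi p] at hle
  have : avg (fun x => (ω x)⁻¹) p ≤ 2 * (A2 ω).toReal / avg ω (lhalf p) := by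
    rw [le_div_iff₀ hu]
    nlinarith [mul_pos hu' hv]
  calc _ ≤ 2 * (A2 ω).toReal / avg ω (lhalf p) * haarCoeff ω (lhalf p) ^ 2 := by gcongr
    _ = _ := by ring

/-- `∑_{K ⊆ J} ⟨ω⁻¹⟩_K ⟨ω, h_{K₋}⟩² ≤ C [ω]_{A₂}² ω(J)`. -/
theorem statement18 :
    ∃ C : ℝ≥0, ∀ ω : ℝ → ℝ, IsWeight ω → A2 ω < ⊤ → ∀ q : ℤ × ℤ,
      ∑' p : {p : ℤ × ℤ // dyad p ⊆ dyad q},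
          ENNReal.ofReal (avg (fun x => (ω x)⁻¹) p.1 * (haarCoeff ω (lhalf p.1)) ^ 2) ≤
        (C : ℝ≥0∞) * (A2 ω) ^ 2 * ENNReal.ofReal (wInt ω q) := by
  refine ⟨96, fun ω hω hA q => ?_⟩
  have hA0 : 0 ≤ (A2 ω).toReal := ENNReal.toReal_nonneg
  have hsub : ∀ p : {p : ℤ × ℤ // dyad p ⊆ dyad q}, dyad (lhalf p.1) ⊆ dyad q := fun p =>
    (Set.subset_union_left.trans (dyad_eq_union p.1).ge).trans p.2
  let g : {p : ℤ × ℤ // dyad p ⊆ dyad q} → {p : ℤ × ℤ // dyad p ⊆ dyad q} :=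
    fun p => ⟨lhalf p.1, hsub p⟩
  have hg : Function.Injective g := fun p p' h =>
    Subtype.ext (lhalf_injective (congrArg Subtype.val h))
  calc _ ≤ ∑' p : {p : ℤ × ℤ // dyad p ⊆ dyad q}, ENNReal.ofReal (2 * (A2 ω).toReal) *
        ENNReal.ofReal (haarCoeff ω (g p).1 ^ 2 / avg ω (g p).1) := by
        refine ENNReal.tsum_le_tsum fun p => ?_
        rw [← ENNReal.ofReal_mul (by positivity)]
        exact ENNReal.ofReal_le_ofReal (avg_inv_mul_haarCoeff_sq_le hω hA p.1)
    _ ≤ ENNReal.ofReal (2 * (A2 ω).toReal) *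
        ENNReal.ofReal (48 * (A2 ω).toReal * wInt ω q) := by
        rw [ENNReal.tsum_mul_left]
        gcongr
        exact (ENNReal.tsum_comp_le_tsum_of_injective hg fun p =>
          ENNReal.ofReal (haarCoeff ω p.1 ^ 2 / avg ω p.1)).trans
          (tsum_haarCoeff_sq_div_avg_le hω hA q)
    _ = _ := by
        rw [ENNReal.ofReal_mul (by norm_num), ENNReal.ofReal_mul (by positivity),
          ENNReal.ofReal_mul (by norm_num), ENNReal.ofReal_toReal hA.ne]
        norm_num
        ring
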